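/- arXiv:2401.05156 — 4 statements merged into one kernel-verified Lean document; each statement's English description precedes it below -/
import Mathlib

section
/- Assume (A1) and let α > 1. Then there exists ε₀ > 0 such that for every ε ∈ (0, ε₀) quenching occurs in finite time: there exists T̃ < ∞ such that every positive classical solution u of the scaled problem on ℝ × [0,T) satisfies T ≤ T̃; in particular no positive classical solution exists on ℝ × [0,∞). -/
open Real Set Filter Topology

noncomputable section

/-- Partial derivative in the space variable `x`. -/
def pdx (u : ℝ → ℝ → ℝ) (x t : ℝ) : ℝ := deriv (fun y => u y t) x

/-- Second partial derivative in the space variable `x`. -/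
def pdxx (u : ℝ → ℝ → ℝ) (x t : ℝ) : ℝ := deriv (fun y => pdx u y t) x

/-- Partial derivative in the time variable `t`. -/
def pdt (u : ℝ → ℝ → ℝ) (x t : ℝ) : ℝ := deriv (fun s => u x s) t

/-- Assumption (A1): `f` is `C¹`, `ℤ`-periodic and positive; `g` is `C²`, `ℤ`-periodic
and positive. -/
def A1 (f g : ℝ → ℝ) : Prop :=
  ContDiff ℝ 1 f ∧ (∀ x, f (x + 1) = f x) ∧ (∀ x, 0 < f x) ∧
  ContDiff ℝ 2 g ∧ (∀ x, g (x + 1) = g x) ∧ (∀ x, 0 < g x)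

/-- A positive classical solution of the scaled problem on `ℝ × [0, T)`, where
`T : EReal` with `0 < T ≤ ∞`:
`u_t = u_xx/((u_x)² + 1) − (n−1)/u + (1/ε) f(x) √((u_x)² + 1)`, `u(x,0) = ε^α g(x)`. -/
structure IsSol (n : ℕ) (f g : ℝ → ℝ) (ε α : ℝ) (T : EReal) (u : ℝ → ℝ → ℝ) : Prop where
  pos : ∀ x t : ℝ, 0 ≤ t → (t : EReal) < T → 0 < u x t
  cont : ContinuousOn (fun p : ℝ × ℝ => u p.1 p.2)
    {p : ℝ × ℝ | 0 ≤ p.2 ∧ (p.2 : EReal) < T}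
  smooth : ContDiffOn ℝ (⊤ : ℕ∞) (fun p : ℝ × ℝ => u p.1 p.2)
    {p : ℝ × ℝ | 0 < p.2 ∧ (p.2 : EReal) < T}
  periodic : ∀ x t : ℝ, u (x + 1) t = u x t
  eqn : ∀ x t : ℝ, 0 < t → (t : EReal) < T →
    pdt u x t = pdxx u x t / ((pdx u x t) ^ 2 + 1) - ((n : ℝ) - 1) / u x t
      + (1 / ε) * f x * Real.sqrt ((pdx u x t) ^ 2 + 1)
  init : ∀ x : ℝ, u x 0 = ε ^ α * g x

/-- A continuous `1`-periodic function is bounded above by a positive constant, strictly. -/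
lemma exists_pos_forall_lt_of_periodic {h : ℝ → ℝ} (hc : Continuous h)
    (hp : ∀ x, h (x + 1) = h x) : ∃ B : ℝ, 0 < B ∧ ∀ x, h x < B := by
  obtain ⟨C, hC⟩ := (isCompact_Icc (a := (0 : ℝ)) (b := 1)).bddAbove_image hc.continuousOn
  refine ⟨max C 0 + 1, by positivity, fun x => ?_⟩
  obtain ⟨y, hy, hxy⟩ := Function.Periodic.exists_mem_Ico₀ (f := h) hp one_pos x
  have : h y ≤ C := hC ⟨y, Ico_subset_Icc_self hy, rfl⟩
  rw [hxy]
  linarith [le_max_left C 0]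

/-- The second derivative is nonpositive at a local maximum. -/
lemma IsLocalMax.deriv_deriv_nonpos {h : ℝ → ℝ} {x : ℝ} (hm : IsLocalMax h x)
    (hc : ContinuousAt h x) : deriv (deriv h) x ≤ 0 := by
  by_contra! hpos
  have hmin : IsLocalMin h x := isLocalMin_of_deriv_deriv_pos hpos hm.deriv_eq_zero hc
  have hconst : h =ᶠ[𝓝 x] fun _ => h x := by
    filter_upwards [hm, hmin] with y h1 h2 using le_antisymm h1 h2
  have h2 := hconst.deriv.deriv_eq
  simp only [deriv_const', deriv_const] at h2
  exact hpos.ne' h2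

/-- A function lying below a line of slope `m` to the left of a contact point has derivative at
least `m` there. -/
lemma HasDerivAt.le_of_eventually_left_le {h : ℝ → ℝ} {d m t : ℝ} (hd : HasDerivAt h d t)
    (hle : ∀ᶠ s in 𝓝[<] t, h s ≤ h t + m * (s - t)) : m ≤ d := by
  have hs : Tendsto (slope h t) (𝓝[<] t) (𝓝 d) :=
    (hasDerivAt_iff_tendsto_slope.1 hd).mono_left (nhdsWithin_mono _ fun _ hy => ne_of_lt hy)
  refine ge_of_tendsto hs ?_
  filter_upwards [hle, self_mem_nhdsWithin] with s h1 (h2 : s < t)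
  rw [slope_def_field, le_div_iff_of_neg (by linarith)]
  linarith

/-- Comparison with a decreasing affine function of time: if the reaction term dominates the
forcing term at height `K`, a solution starting below `K` stays below `K - c / 2 * t`. -/
lemma IsSol.lt_affine {n : ℕ} {f g : ℝ → ℝ} {ε α : ℝ} {T : EReal} {u : ℝ → ℝ → ℝ}
    (hu : IsSol n f g ε α T u) {K c : ℝ} (hc : 0 < c)
    (hf : ∀ x, 1 / ε * f x ≤ c) (hK : 2 * c * K ≤ (n : ℝ) - 1)
    (h0 : ∀ x, u x 0 < K) {x t : ℝ} (ht : 0 ≤ t) (htT : (t : EReal) < T) :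
    u x t < K - c / 2 * t := by
  by_contra! hcon
  have hlt : ∀ s ≤ t, (s : EReal) < T := fun s hs =>
    lt_of_le_of_lt (EReal.coe_le_coe_iff.2 hs) htT
  set S : Set (ℝ × ℝ) := Icc 0 1 ×ˢ Icc 0 t
  have hS : IsCompact S := isCompact_Icc.prod isCompact_Icc
  have hcS : ContinuousOn (fun p : ℝ × ℝ => u p.1 p.2 - (K - c / 2 * p.2)) S :=
    (hu.cont.mono fun p hp => ⟨hp.2.1, hlt _ hp.2.2⟩).sub (by fun_prop)
  set Z : Set (ℝ × ℝ) := S ∩ (fun p : ℝ × ℝ => u p.1 p.2 - (K - c / 2 * p.2)) ⁻¹' Ici 0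
  have hZ : IsCompact Z := hS.of_isClosed_subset
    (hcS.preimage_isClosed_of_isClosed hS.isClosed isClosed_Ici) inter_subset_left
  have hmem : ∀ y s, 0 ≤ s → s ≤ t → K - c / 2 * s ≤ u y s → ∃ z, (z, s) ∈ Z := by
    intro y s hs hst hys
    obtain ⟨z, hz, hyz⟩ := Function.Periodic.exists_mem_Ico₀ (f := fun y => u y s)
      (fun y => hu.periodic y s) one_pos y
    refine ⟨z, ⟨Ico_subset_Icc_self hz, hs, hst⟩, ?_⟩
    simp only [mem_preimage, mem_Ici] at hyz ⊢
    linarith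
  obtain ⟨z, hz⟩ := hmem x t ht le_rfl hcon
  obtain ⟨⟨x₀, t₀⟩, hp, hmin⟩ := hZ.exists_isMinOn ⟨_, hz⟩ continuous_snd.continuousOn
  obtain ⟨⟨-, ht₀, ht₀t⟩, hge⟩ := hp
  simp only [mem_preimage, mem_Ici, sub_nonneg] at ht₀ ht₀t hge
  have hbefore : ∀ y s, 0 ≤ s → s < t₀ → u y s < K - c / 2 * s := by
    intro y s hs hst
    by_contra! hys
    obtain ⟨z, hz⟩ := hmem y s hs (hst.le.trans ht₀t) hys
    exact absurd (hmin hz) (not_le.2 hst)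
  have ht₀pos : 0 < t₀ := by
    refine ht₀.lt_of_ne fun h => ?_
    subst h
    linarith [h0 x₀]
  have hnear : ∀ᶠ s in 𝓝[<] t₀, 0 ≤ s ∧ s < t₀ := by
    filter_upwards [Ioo_mem_nhdsLT ht₀pos] with s hs using ⟨hs.1.le, hs.2⟩
  have hat : ∀ y, u y t₀ ≤ K - c / 2 * t₀ := by
    intro y
    have h1 : Tendsto (fun s => u y s) (𝓝[<] t₀) (𝓝 (u y t₀)) := by
      refine Tendsto.comp (g := fun p : ℝ × ℝ => u p.1 p.2)
        (hu.cont (y, t₀) ⟨ht₀, hlt _ ht₀t⟩)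
        (tendsto_nhdsWithin_iff.2 ⟨?_, ?_⟩ : Tendsto (fun s => (y, s)) (𝓝[<] t₀) _)
      · exact Continuous.tendsto' (by fun_prop) _ _ rfl |>.mono_left nhdsWithin_le_nhds
      · filter_upwards [hnear] with s hs using ⟨hs.1, hlt _ (hs.2.le.trans ht₀t)⟩
    have h2 : Tendsto (fun s => K - c / 2 * s) (𝓝[<] t₀) (𝓝 (K - c / 2 * t₀)) :=
      Continuous.tendsto' (by fun_prop) _ _ rfl |>.mono_left nhdsWithin_le_nhds
    refine le_of_tendsto_of_tendsto h1 h2 ?_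
    filter_upwards [hnear] with s hs using (hbefore y s hs.1 hs.2).le
  have hmax : IsLocalMax (fun y => u y t₀) x₀ := Eventually.of_forall fun y => (hat y).trans hge
  have hcont : ContinuousAt (fun y => u y t₀) x₀ := by
    refine Continuous.continuousAt (continuousOn_univ.1 ?_)
    exact hu.cont.comp (f := fun y : ℝ => (y, t₀)) (by fun_prop) fun y _ => ⟨ht₀, hlt _ ht₀t⟩
  have hx : pdx u x₀ t₀ = 0 := hmax.deriv_eq_zero
  have hxx : pdxx u x₀ t₀ ≤ 0 := hmax.deriv_deriv_nonpos hcont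
  have hupos := hu.pos x₀ t₀ ht₀ (hlt _ ht₀t)
  have hreac : 2 * c ≤ ((n : ℝ) - 1) / u x₀ t₀ := by
    rw [le_div_iff₀ hupos]
    have : u x₀ t₀ ≤ K := (hat x₀).trans (by nlinarith)
    nlinarith
  have ht : pdt u x₀ t₀ ≤ -c := by
    rw [hu.eqn x₀ t₀ ht₀pos (hlt _ ht₀t), hx]
    norm_num
    have := hf x₀
    rw [one_div] at this
    linarith
  have hdiff : HasDerivAt (fun s => u x₀ s) (pdt u x₀ t₀) t₀ :=
    (differentiableAt_of_deriv_ne_zero (ht.trans_lt (neg_lt_zero.2 hc)).ne).hasDerivAt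
  have := hdiff.le_of_eventually_left_le (m := -(c / 2)) (by
    filter_upwards [hnear] with s hs
    linarith [hbefore x₀ s hs.1 hs.2])
  linarith

/-- Under (A1), for `α > 1` there is `ε₀ > 0` such that for every
`ε ∈ (0, ε₀)` quenching occurs in finite time: there is a finite `T̃` such that every
positive classical solution of the scaled problem on `ℝ × [0,T)` satisfies `T ≤ T̃`
(in particular there is no positive classical solution on `ℝ × [0,∞)`). -/
theorem quenching_supercritical (n : ℕ) (hn : 2 ≤ n) (f g : ℝ → ℝ) (hA1 : A1 f g)
    (α : ℝ) (hα : 1 < α) :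
    ∃ ε₀ : ℝ, 0 < ε₀ ∧ ∀ ε : ℝ, 0 < ε → ε < ε₀ →
      ∃ Tmax : ℝ, ∀ T : EReal, 0 < T → ∀ u : ℝ → ℝ → ℝ,
        IsSol n f g ε α T u → T ≤ (Tmax : EReal) := by
  obtain ⟨hf, hfp, hfpos, hg, hgp, -⟩ := hA1
  obtain ⟨F, hF, hfF⟩ := exists_pos_forall_lt_of_periodic hf.continuous hfp
  obtain ⟨G, hG, hgG⟩ := exists_pos_forall_lt_of_periodic hg.continuous hgp
  have hn1 : (1 : ℝ) ≤ n - 1 := by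
    have : (2 : ℝ) ≤ n := by exact_mod_cast hn
    linarith
  have hlim : Tendsto (fun ε : ℝ => 2 * F * G * ε ^ (α - 1)) (𝓝 0) (𝓝 0) := by
    have := (Real.continuousAt_rpow_const 0 (α - 1) (Or.inr (by linarith))).tendsto.const_mul
      (2 * F * G)
    rwa [Real.zero_rpow (by linarith), mul_zero] at this
  obtain ⟨ε₀, hε₀, hsmall⟩ := Metric.eventually_nhds_iff.1 (hlim.eventually_lt_const one_pos)
  refine ⟨ε₀, hε₀, fun ε hε hεε₀ => ?_⟩
  have hsm : 2 * F * G * ε ^ (α - 1) < 1 :=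
    hsmall (by rwa [Real.dist_eq, sub_zero, abs_of_pos hε])
  have hεα : 0 < ε ^ α := Real.rpow_pos_of_pos hε α
  have hc : 0 < F / ε := div_pos hF hε
  refine ⟨ε ^ α * G / (F / ε / 2), fun T _ u hu => ?_⟩
  by_contra! hT
  have hpos : 0 < u 0 (ε ^ α * G / (F / ε / 2)) := hu.pos _ _ (by positivity) hT
  have hlt := hu.lt_affine (K := ε ^ α * G) hc
    (fun x => by rw [one_div_mul_eq_div]; gcongr; exact (hfF x).le)
    (by
      have : ε ^ (α - 1) = ε ^ α / ε := by rw [Real.rpow_sub hε, Real.rpow_one]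
      have : 2 * (F / ε) * (ε ^ α * G) = 2 * F * G * ε ^ (α - 1) := by rw [this]; ring
      linarith)
    (fun x => by rw [hu.init]; exact mul_lt_mul_of_pos_left (hgG x) hεα)
    (x := 0) (by positivity) hT
  rw [mul_div_cancel₀ _ (by positivity)] at hlt
  linarith
end
end

section
/- Assume (A1) and let 0 < α < 1. Then there exists ε₀ > 0 such that for every ε ∈ (0, ε₀), every positive classical solution u of the scaled problem on ℝ × [0,T) satisfies u(x,t) ≥ ε^α · (min_{ℝ} g) for all (x,t) ∈ ℝ × [0,T); in particular quenching never occurs. -/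
open Real Set Filter Topology

noncomputable section

theorem Function.Periodic.exists_eq_sInf_range_and_le {f : ℝ → ℝ} (hf : Continuous f)
    (hper : ∀ x, f (x + 1) = f x) : (∃ x, f x = sInf (range f)) ∧ ∀ x, sInf (range f) ≤ f x := by
  have hc : IsCompact (range f) :=
    Function.Periodic.compact_of_continuous (c := 1) hper one_ne_zero hf
  exact ⟨hc.sInf_mem (range_nonempty f), fun x => csInf_le hc.bddBelow (mem_range_self x)⟩

theorem IsLocalMin.deriv_deriv_nonneg {φ : ℝ → ℝ} {x : ℝ} (h : IsLocalMin φ x)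
    (hc : ContinuousAt φ x) : 0 ≤ deriv (deriv φ) x := by
  by_contra! hneg
  have hmax : IsLocalMax φ x := isLocalMax_of_deriv_deriv_neg hneg h.deriv_eq_zero hc
  have hconst : φ =ᶠ[𝓝 x] fun _ => φ x := by
    filter_upwards [h, hmax] with y h1 h2 using le_antisymm h2 h1
  have : deriv (deriv φ) x = 0 := by
    rw [hconst.deriv.deriv_eq]
    simp
  linarith

theorem deriv_nonpos_of_forall_lt_le {φ : ℝ → ℝ} {a t : ℝ} (hat : a < t)
    (h : ∀ s, a < s → s < t → φ t ≤ φ s) : deriv φ t ≤ 0 := by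
  by_cases hd : DifferentiableAt ℝ φ t
  · have hs := (hasDerivAt_iff_tendsto_slope_left_right.1 hd.hasDerivAt).1
    refine le_of_tendsto hs ?_
    filter_upwards [Ioo_mem_nhdsLT hat] with s hs
    rw [slope_def_field]
    exact div_nonpos_of_nonneg_of_nonpos (by linarith [h s hs.1 hs.2]) (by linarith [hs.2])
  · exact (deriv_zero_of_not_differentiableAt hd).le

theorem isOpen_Ioo_time (T : EReal) : IsOpen {p : ℝ × ℝ | 0 < p.2 ∧ (p.2 : EReal) < T} :=
  (isOpen_lt continuous_const continuous_snd).inter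
    (isOpen_lt (continuous_coe_real_ereal.comp continuous_snd) continuous_const)

theorem IsSol.continuousAt {n : ℕ} {f g : ℝ → ℝ} {ε α : ℝ} {T : EReal} {u : ℝ → ℝ → ℝ}
    (hu : IsSol n f g ε α T u) {x t : ℝ} (ht : 0 < t) (htT : (t : EReal) < T) :
    ContinuousAt (fun p : ℝ × ℝ => u p.1 p.2) (x, t) :=
  hu.smooth.continuousOn.continuousAt ((isOpen_Ioo_time T).mem_nhds ⟨ht, htT⟩)

/-- If `k` exceeds the level `(n - 1) ε / c`, above which the driving force dominates the curvature
term, then a solution that starts above `k` stays above `k`. -/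
theorem IsSol.level_lt {n : ℕ} (hn : 2 ≤ n) {f g : ℝ → ℝ} {ε α : ℝ} (hε : 0 < ε) {T : EReal}
    {u : ℝ → ℝ → ℝ} (hu : IsSol n f g ε α T u) {c k : ℝ} (hc : 0 < c) (hf : ∀ x, c ≤ f x)
    (hk : ((n : ℝ) - 1) * ε / c < k) (hg : ∀ x, k < u x 0)
    {x t : ℝ} (ht : 0 ≤ t) (htT : (t : EReal) < T) : k < u x t := by
  by_contra! hle
  have hn' : (0 : ℝ) < (n : ℝ) - 1 := by
    have : (2 : ℝ) ≤ n := by exact_mod_cast hn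
    linarith
  have hk0 : 0 < k := lt_trans (by positivity) hk
  have hper : ∀ s, Function.Periodic (fun y => u y s) 1 := fun s y => hu.periodic y s
  have hT : ∀ s ≤ t, (s : EReal) < T := fun s hs =>
    lt_of_le_of_lt (EReal.coe_le_coe_iff.2 hs) htT
  set K : Set (ℝ × ℝ) := Icc 0 1 ×ˢ Icc 0 t with hK
  have hcontK : ContinuousOn (fun p : ℝ × ℝ => u p.1 p.2) K :=
    hu.cont.mono fun p hp => ⟨hp.2.1, hT _ hp.2.2⟩
  have hKc : IsCompact K := isCompact_Icc.prod isCompact_Icc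
  have hSc : IsCompact (K ∩ (fun p : ℝ × ℝ => u p.1 p.2) ⁻¹' Iic k) :=
    hKc.of_isClosed_subset (hcontK.preimage_isClosed_of_isClosed hKc.isClosed isClosed_Iic)
      inter_subset_left
  have hrep : ∀ y s, ∃ z ∈ Icc (0 : ℝ) 1, u y s = u z s := fun y s => by
    obtain ⟨z, hz, h⟩ := (hper s).exists_mem_Ico₀ one_pos y
    exact ⟨z, ⟨hz.1, hz.2.le⟩, h⟩
  obtain ⟨z, hz, hzx⟩ := hrep x t
  obtain ⟨⟨x₁, t₁⟩, ⟨⟨hx₁, ht₁⟩, hle₁⟩, hmin⟩ := hSc.exists_isMinOn (f := Prod.snd)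
    ⟨(z, t), ⟨hz, ⟨ht, le_rfl⟩⟩, by simpa [← hzx] using hle⟩ continuous_snd.continuousOn
  simp only [mem_Icc, mem_preimage, mem_Iic] at hx₁ ht₁ hle₁
  have hbefore : ∀ y s, 0 ≤ s → s < t₁ → k < u y s := fun y s hs hst => by
    by_contra! hle'
    obtain ⟨w, hw, hwy⟩ := hrep y s
    have := hmin (a := (w, s)) ⟨⟨hw, ⟨hs, hst.le.trans ht₁.2⟩⟩, by simpa [← hwy] using hle'⟩
    exact absurd hst (not_lt.2 this)
  have ht₁0 : 0 < t₁ := by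
    refine lt_of_le_of_ne ht₁.1 fun h => ?_
    subst h
    exact absurd (hg x₁) (not_lt.2 hle₁)
  have ht₁T := hT t₁ ht₁.2
  have hge : ∀ y, k ≤ u y t₁ := fun y => by
    have hcy : ContinuousAt (fun s => u y s) t₁ :=
      (hu.continuousAt (x := y) ht₁0 ht₁T).comp (f := fun s => (y, s)) (by fun_prop)
    refine ge_of_tendsto (hcy.tendsto.mono_left (nhdsWithin_le_nhds (s := Iio t₁))) ?_
    filter_upwards [Ioo_mem_nhdsLT ht₁0] with s hs using (hbefore y s hs.1.le hs.2).le
  have heq : u x₁ t₁ = k := le_antisymm hle₁ (hge x₁)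
  have hlm : IsLocalMin (fun y => u y t₁) x₁ :=
    Eventually.of_forall fun y => by simpa only [heq] using hge y
  have hcx : ContinuousAt (fun y => u y t₁) x₁ :=
    (hu.continuousAt (x := x₁) ht₁0 ht₁T).comp (f := fun y => (y, t₁)) (by fun_prop)
  have hx0 : pdx u x₁ t₁ = 0 := hlm.deriv_eq_zero
  have hxx : 0 ≤ pdxx u x₁ t₁ := hlm.deriv_deriv_nonneg hcx
  have htt : pdt u x₁ t₁ ≤ 0 := deriv_nonpos_of_forall_lt_le ht₁0 fun s hs hst => by
    simpa only [heq] using (hbefore x₁ s hs.le hst).le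
  have heqn := hu.eqn x₁ t₁ ht₁0 ht₁T
  rw [hx0, heq] at heqn
  norm_num at heqn
  have hlt : ((n : ℝ) - 1) / k < ε⁻¹ * f x₁ := by
    calc ((n : ℝ) - 1) / k < ε⁻¹ * c := by
          rw [div_lt_iff₀ hc] at hk
          rw [div_lt_iff₀ hk0, mul_assoc, ← div_eq_inv_mul, lt_div_iff₀ hε]
          linarith
      _ ≤ ε⁻¹ * f x₁ := by gcongr; exact hf x₁
  linarith

/-- Under (A1), for `0 < α < 1` there is `ε₀ > 0` such that for every
`ε ∈ (0, ε₀)`, every positive classical solution of the scaled problem on `ℝ × [0,T)`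
satisfies `u(x,t) ≥ ε^α · min g`; in particular quenching never occurs. -/
theorem no_quenching_subcritical (n : ℕ) (hn : 2 ≤ n) (f g : ℝ → ℝ) (hA1 : A1 f g)
    (α : ℝ) (hα0 : 0 < α) (hα1 : α < 1) :
    ∃ ε₀ : ℝ, 0 < ε₀ ∧ ∀ ε : ℝ, 0 < ε → ε < ε₀ →
      ∀ T : EReal, 0 < T → ∀ u : ℝ → ℝ → ℝ, IsSol n f g ε α T u →
        ∀ x t : ℝ, 0 ≤ t → (t : EReal) < T →
          ε ^ α * sInf (Set.range g) ≤ u x t := by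
  obtain ⟨hf, hfp, hf0, hg, hgp, hg0⟩ := hA1
  obtain ⟨⟨a, ha⟩, hfc⟩ := Function.Periodic.exists_eq_sInf_range_and_le hf.continuous hfp
  obtain ⟨⟨b, hb⟩, hgm⟩ := Function.Periodic.exists_eq_sInf_range_and_le hg.continuous hgp
  rw [← ha] at hfc
  rw [← hb] at hgm ⊢
  have hc := hf0 a
  have hm := hg0 b
  have hn0 : (0 : ℝ) < n := by exact_mod_cast (by omega : 0 < n)
  have h1α : 0 < 1 - α := by linarith
  refine ⟨(f a * g b / n) ^ (1 - α)⁻¹, by positivity,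
    fun ε hε hε₀ T _ u hu x t ht htT => ?_⟩
  have hpow : ε ^ (1 - α) < f a * g b / n :=
    (lt_rpow_inv_iff_of_pos hε.le (by positivity) h1α).1 hε₀
  have hεα : 0 < ε ^ α := rpow_pos_of_pos hε α
  have hsplit : ε = ε ^ (1 - α) * ε ^ α := by
    rw [← rpow_add hε]
    simp
  have hK : ((n : ℝ) - 1) * ε / f a < ε ^ α * g b := by
    rw [lt_div_iff₀ hn0] at hpow
    rw [div_lt_iff₀ hc]
    have := mul_lt_mul_of_pos_right hpow hεα
    nlinarith
  by_contra! hlt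
  obtain ⟨k, hk, hkM⟩ := exists_between (max_lt hK hlt)
  rw [max_lt_iff] at hk
  refine lt_asymm hk.2 (hu.level_lt hn hε hc hfc hk.1 (fun y => ?_) ht htT)
  rw [hu.init]
  exact hkM.trans_le (by gcongr; exact hgm y)
end
end

section
/- Assume (A1), α = 1, ε ∈ (0,1), and τ > 0. Let u be a positive classical solution of the scaled problem on ℝ × [0,τ) whose time derivative u_t extends continuously to ℝ × [0,τ), and suppose there is c* > 0 with u(x,t) ≥ ε c* for all (x,t) ∈ ℝ × (0,τ). Set C₁ := ε² max_{ℝ}|g''| + (max_{ℝ} f)·√(ε² max_{ℝ}(g')² + 1) + 2(n−1)/min_{ℝ} g. Then |ε u_t(x,t)| ≤ C₁ · exp((n−1)t/(ε² c*²)) for all (x,t) ∈ ℝ × (0,τ). In particular, for every k ∈ ℕ there is a constant C (depending only on n, f, g, c*, τ, k, not on ε) such that |ε u_t(x,t)| ≤ C for all (x,t) ∈ ℝ × (0, min(τ, k ε² c*²/(n−1))). -/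
open Real Set Filter Topology

noncomputable section

/-- The constant `C₁ = ε² max|g''| + (max f)·√(ε² max (g')² + 1) + 2(n−1)/min g`. -/
def C1 (n : ℕ) (f g : ℝ → ℝ) (ε : ℝ) : ℝ :=
  ε ^ 2 * sSup (Set.range fun x => |deriv (deriv g) x|) +
    sSup (Set.range f) * Real.sqrt (ε ^ 2 * sSup (Set.range fun x => (deriv g x) ^ 2) + 1) +
    2 * ((n : ℝ) - 1) / sInf (Set.range g)

/-- Necessary second-order condition at a global maximum. -/
lemma deriv_deriv_nonpos_of_forall_le {φ : ℝ → ℝ} {x₀ : ℝ} (hφ : Continuous φ)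
    (hmax : ∀ x, φ x ≤ φ x₀) : deriv (deriv φ) x₀ ≤ 0 := by
  by_contra! hpos
  have hloc : IsLocalMax φ x₀ := Eventually.of_forall hmax
  have hmin := isLocalMin_of_deriv_deriv_pos hpos hloc.deriv_eq_zero hφ.continuousAt
  have hconst : φ =ᶠ[𝓝 x₀] fun _ => φ x₀ := by
    filter_upwards [hmin] with x hx using le_antisymm (hmax x) hx
  have h := hconst.deriv.deriv_eq
  simp at h
  exact hpos.ne' h

/-- One-sided first-order condition at a maximum over the past. -/
lemma deriv_nonneg_of_forall_le_left {F : ℝ → ℝ} {F' t₀ : ℝ} (ht₀ : 0 < t₀)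
    (hF : HasDerivAt F F' t₀) (hmax : ∀ t, 0 ≤ t → t ≤ t₀ → F t ≤ F t₀) : 0 ≤ F' := by
  refine ge_of_tendsto hF.tendsto_slope_zero_left ?_
  filter_upwards [Ioo_mem_nhdsLT (show -t₀ < 0 by linarith)] with s hs
  have h := hmax (t₀ + s) (by linarith [hs.1]) (by linarith [hs.2])
  exact mul_nonneg_of_nonpos_of_nonpos (inv_nonpos.mpr hs.2.le) (by linarith)

/-- A function continuous on a closed time slab and periodic in space attains its maximum. -/
lemma exists_forall_le_of_periodic {w : ℝ → ℝ → ℝ} {T : ℝ} (hT : 0 ≤ T)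
    (hper : ∀ x t, 0 ≤ t → t ≤ T → w (x + 1) t = w x t)
    (hcont : ContinuousOn (fun p : ℝ × ℝ => w p.1 p.2) {p | 0 ≤ p.2 ∧ p.2 ≤ T}) :
    ∃ x₀ t₀, 0 ≤ t₀ ∧ t₀ ≤ T ∧ ∀ x t, 0 ≤ t → t ≤ T → w x t ≤ w x₀ t₀ := by
  obtain ⟨p, hp, hmax⟩ := (isCompact_Icc (a := (0 : ℝ)) (b := 1)).prod
    (isCompact_Icc (a := (0 : ℝ)) (b := T)) |>.exists_isMaxOn
    ⟨(0, 0), by simp [hT]⟩ (hcont.mono fun q hq => ⟨hq.2.1, hq.2.2⟩)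
  refine ⟨p.1, p.2, hp.2.1, hp.2.2, fun x t h0 h1 => ?_⟩
  have hp' : Function.Periodic (fun y => w y t) 1 := fun y => hper y t h0 h1
  obtain ⟨y, hy, hxy⟩ := hp'.exists_mem_Ico₀ one_pos x
  have hxy' : w x t = w y t := hxy
  rw [hxy']
  exact hmax (show (y, t) ∈ _ from ⟨⟨hy.1, hy.2.le⟩, h0, h1⟩)

/-- Comparison principle for spatially periodic functions, in the form of a criterion at interior
contact points. -/
lemma sub_le_mul_exp_of_contact {u v : ℝ → ℝ → ℝ} {T L M : ℝ} (hM : 0 ≤ M)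
    (hu_per : ∀ x t, 0 ≤ t → t ≤ T → u (x + 1) t = u x t)
    (hv_per : ∀ x t, 0 ≤ t → t ≤ T → v (x + 1) t = v x t)
    (hu : ContinuousOn (fun p : ℝ × ℝ => u p.1 p.2) {p | 0 ≤ p.2 ∧ p.2 ≤ T})
    (hv : ContinuousOn (fun p : ℝ × ℝ => v p.1 p.2) {p | 0 ≤ p.2 ∧ p.2 ≤ T})
    (hu_t : ∀ x t, 0 < t → t ≤ T → DifferentiableAt ℝ (u x) t)
    (hv_t : ∀ x t, 0 < t → t ≤ T → DifferentiableAt ℝ (v x) t)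
    (hu_x : ∀ t, 0 < t → t ≤ T → ContDiff ℝ 2 fun y => u y t)
    (hv_x : ∀ t, 0 < t → t ≤ T → ContDiff ℝ 2 fun y => v y t)
    (hinit : ∀ x, u x 0 - v x 0 ≤ M)
    (hcontact : ∀ x t, 0 < t → t ≤ T → 0 < u x t - v x t → pdx u x t = pdx v x t →
      pdxx u x t ≤ pdxx v x t → pdt u x t - pdt v x t ≤ L * (u x t - v x t)) :
    ∀ x t, 0 ≤ t → t ≤ T → u x t - v x t ≤ M * exp (L * t) := by
  intro x t ht htT
  suffices key : ∀ L', L < L' → u x t - v x t ≤ M * exp (L' * t) by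
    have hlim : Tendsto (fun L' => M * exp (L' * t)) (𝓝[>] L) (𝓝 (M * exp (L * t))) :=
      (Continuous.tendsto (by fun_prop) L).mono_left nhdsWithin_le_nhds
    exact ge_of_tendsto hlim (by filter_upwards [self_mem_nhdsWithin] with L' hL' using key L' hL')
  intro L' hL'
  obtain ⟨x₀, t₀, ht₀, ht₀T, hmax⟩ := exists_forall_le_of_periodic
    (w := fun x t => (u x t - v x t) * exp (-(L' * t))) (ht.trans htT)
    (fun x t h0 h1 => by simp only [hu_per x t h0 h1, hv_per x t h0 h1])
    ((hu.sub hv).mul (by fun_prop))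
  suffices hle : (u x₀ t₀ - v x₀ t₀) * exp (-(L' * t₀)) ≤ M by
    have h := (hmax x t ht htT).trans hle
    rwa [exp_neg, ← div_eq_mul_inv, div_le_iff₀ (exp_pos _)] at h
  by_contra! hgt
  have ht₀pos : 0 < t₀ := by
    rcases ht₀.eq_or_lt with h | h
    · subst h
      have := hinit x₀
      simp at hgt
      linarith
    · exact h
  have hw : 0 < u x₀ t₀ - v x₀ t₀ := pos_of_mul_pos_left (hM.trans_lt hgt) (exp_pos _).le
  have hspace : ∀ y, u y t₀ - v y t₀ ≤ u x₀ t₀ - v x₀ t₀ := fun y =>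
    le_of_mul_le_mul_right (hmax y t₀ ht₀ ht₀T) (exp_pos _)
  have hux := hu_x t₀ ht₀pos ht₀T
  have hvx := hv_x t₀ ht₀pos ht₀T
  have hud := hux.differentiable two_ne_zero
  have hvd := hvx.differentiable two_ne_zero
  have hudd : Differentiable ℝ fun y => pdx u y t₀ := hux.differentiable_deriv_two
  have hvdd : Differentiable ℝ fun y => pdx v y t₀ := hvx.differentiable_deriv_two
  have hderiv : deriv (fun y => u y t₀ - v y t₀) = fun y => pdx u y t₀ - pdx v y t₀ :=
    funext fun y => deriv_fun_sub (hud y) (hvd y)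
  have h1 : pdx u x₀ t₀ = pdx v x₀ t₀ := by
    have h : deriv (fun y => u y t₀ - v y t₀) x₀ = 0 :=
      IsLocalMax.deriv_eq_zero (Eventually.of_forall hspace)
    rw [hderiv] at h
    exact sub_eq_zero.mp h
  have h2 : pdxx u x₀ t₀ ≤ pdxx v x₀ t₀ := by
    have h := deriv_deriv_nonpos_of_forall_le (φ := fun y => u y t₀ - v y t₀)
      (hux.continuous.sub hvx.continuous) hspace
    rw [hderiv, deriv_fun_sub (hudd x₀) (hvdd x₀)] at h
    exact sub_nonpos.mp h
  have htime : HasDerivAt (fun t => (u x₀ t - v x₀ t) * exp (-(L' * t)))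
      ((pdt u x₀ t₀ - pdt v x₀ t₀) * exp (-(L' * t₀)) +
        (u x₀ t₀ - v x₀ t₀) * (exp (-(L' * t₀)) * -(L' * 1))) t₀ :=
    ((hu_t x₀ t₀ ht₀pos ht₀T).hasDerivAt.sub (hv_t x₀ t₀ ht₀pos ht₀T).hasDerivAt).mul
      (((hasDerivAt_id t₀).const_mul L').neg.exp)
  have h3 := deriv_nonneg_of_forall_le_left ht₀pos htime
    fun s hs hst => hmax x₀ s hs (hst.trans ht₀T)
  have h4 := hcontact x₀ t₀ ht₀pos ht₀T hw h1 h2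
  have h5 : 0 ≤ (pdt u x₀ t₀ - pdt v x₀ t₀ - L' * (u x₀ t₀ - v x₀ t₀)) * exp (-(L' * t₀)) := by
    linarith
  have h6 := nonneg_of_mul_nonneg_left h5 (exp_pos _)
  nlinarith [mul_pos (sub_pos.mpr hL') hw]

/-- At a contact point the right-hand sides of the equation differ by at most the contribution of
the zeroth-order term. -/
lemma rhs_sub_le {P N m q₁ q₂ a b r : ℝ} (hP : 0 < P) (hN : 0 ≤ N) (hm : 0 < m) (ha : m ≤ a)
    (hb : m ≤ b) (hab : 0 < a - b) (hq : q₁ ≤ q₂) :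
    (q₁ / P - N / a + r) - (q₂ / P - N / b + r) ≤ N / m ^ 2 * (a - b) := by
  have ha' := hm.trans_le ha
  have hb' := hm.trans_le hb
  have h1 : q₁ / P ≤ q₂ / P := by gcongr
  have h2 : N / b - N / a = N / (a * b) * (a - b) := by field_simp
  have h3 : N / (a * b) ≤ N / m ^ 2 := by
    rw [sq]
    gcongr
  nlinarith [mul_le_mul_of_nonneg_right h3 hab.le]

section Data

variable {n : ℕ} {f g : ℝ → ℝ}

lemma A1.continuous_deriv (h : A1 f g) : Continuous (deriv g) :=
  h.2.2.2.1.continuous_deriv (by norm_num)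

lemma A1.continuous_deriv_deriv (h : A1 f g) : Continuous (deriv (deriv g)) := by
  have := h.2.2.2.1.iterate_deriv' 0 2
  exact this.continuous

lemma periodic_deriv {φ : ℝ → ℝ} (h : Function.Periodic φ 1) :
    Function.Periodic (deriv φ) 1 := fun x => by
  rw [← deriv_comp_add_const, show (fun y => φ (y + 1)) = φ from funext h]

lemma le_sSup_range {φ : ℝ → ℝ} (h : Function.Periodic φ 1) (hc : Continuous φ) (x : ℝ) :
    φ x ≤ sSup (range φ) :=
  le_csSup (h.compact_of_continuous one_ne_zero hc).bddAbove (mem_range_self x)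

lemma A1.le_sSup_f (h : A1 f g) (x : ℝ) : f x ≤ sSup (range f) :=
  le_sSup_range h.2.1 h.1.continuous x

lemma A1.sq_deriv_le (h : A1 f g) (x : ℝ) :
    deriv g x ^ 2 ≤ sSup (range fun x => deriv g x ^ 2) :=
  le_sSup_range (φ := fun x => deriv g x ^ 2)
    (fun y => by simp only [periodic_deriv h.2.2.2.2.1 y]) (h.continuous_deriv.pow 2) x

lemma A1.abs_deriv_deriv_le (h : A1 f g) (x : ℝ) :
    |deriv (deriv g) x| ≤ sSup (range fun x => |deriv (deriv g) x|) :=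
  le_sSup_range (φ := fun x => |deriv (deriv g) x|)
    (fun y => by simp only [periodic_deriv (periodic_deriv h.2.2.2.2.1) y])
    h.continuous_deriv_deriv.abs x

lemma A1.isCompact_range_g (h : A1 f g) : IsCompact (range g) :=
  Function.Periodic.compact_of_continuous h.2.2.2.2.1 one_ne_zero h.2.2.2.1.continuous

lemma A1.sInf_g_pos (h : A1 f g) : 0 < sInf (range g) := by
  obtain ⟨x, hx⟩ := h.isCompact_range_g.sInf_mem (range_nonempty g)
  exact hx ▸ h.2.2.2.2.2 x

lemma A1.sInf_g_le (h : A1 f g) (x : ℝ) : sInf (range g) ≤ g x :=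
  csInf_le h.isCompact_range_g.bddBelow (mem_range_self x)

lemma A1.C1_nonneg (h : A1 f g) (hn : 2 ≤ n) (ε : ℝ) : 0 ≤ C1 n f g ε := by
  have hn' : (2 : ℝ) ≤ n := by exact_mod_cast hn
  have h1 := (abs_nonneg _).trans (h.abs_deriv_deriv_le 0)
  have h2 := (h.2.2.1 0).le.trans (h.le_sSup_f 0)
  have h3 := h.sInf_g_pos
  have h4 : 0 ≤ 2 * ((n : ℝ) - 1) := by linarith
  unfold C1
  positivity

lemma A1.C1_le_C1_one (h : A1 f g) {ε : ℝ} (hε : 0 < ε) (hε1 : ε < 1) :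
    C1 n f g ε ≤ C1 n f g 1 := by
  have h1 := (abs_nonneg _).trans (h.abs_deriv_deriv_le 0)
  have h2 := (h.2.2.1 0).le.trans (h.le_sSup_f 0)
  have h3 := (sq_nonneg _).trans (h.sq_deriv_le 0)
  unfold C1
  gcongr

end Data

section Solution

variable {n : ℕ} {f g : ℝ → ℝ} {ε τ : ℝ} {u : ℝ → ℝ → ℝ}

lemma IsSol.contDiffAt {α : ℝ} (h : IsSol n f g ε α (τ : EReal) u) {x t : ℝ} (ht : 0 < t)
    (htτ : t < τ) : ContDiffAt ℝ (⊤ : ℕ∞) (fun p : ℝ × ℝ => u p.1 p.2) (x, t) := by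
  refine h.smooth.contDiffAt (IsOpen.mem_nhds ?_ ⟨ht, EReal.coe_lt_coe_iff.mpr htτ⟩)
  simp only [EReal.coe_lt_coe_iff]
  exact (isOpen_lt continuous_const continuous_snd).inter
    (isOpen_lt continuous_snd continuous_const)

lemma IsSol.differentiableAt_time {α : ℝ} (h : IsSol n f g ε α (τ : EReal) u) {x t : ℝ}
    (ht : 0 < t) (htτ : t < τ) : DifferentiableAt ℝ (u x) t :=
  ((h.contDiffAt ht htτ).differentiableAt (by simp)).comp t
    (f := fun s => (x, s)) (by fun_prop)

lemma IsSol.contDiff_space {α : ℝ} (h : IsSol n f g ε α (τ : EReal) u) {t : ℝ}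
    (ht : 0 < t) (htτ : t < τ) : ContDiff ℝ 2 fun y => u y t :=
  contDiff_iff_contDiffAt.mpr fun x =>
    ((h.contDiffAt ht htτ).comp x (f := fun y => (y, t)) (by fun_prop)).of_le
      (WithTop.coe_le_coe.mpr le_top)

lemma IsSol.continuousOn {α T : ℝ} (h : IsSol n f g ε α (τ : EReal) u) (hT : T < τ) :
    ContinuousOn (fun p : ℝ × ℝ => u p.1 p.2) {p | 0 ≤ p.2 ∧ p.2 ≤ T} :=
  h.cont.mono fun _ hp => ⟨hp.1, EReal.coe_lt_coe_iff.mpr (hp.2.trans_lt hT)⟩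

lemma IsSol.init_eq (h : IsSol n f g ε 1 (τ : EReal) u) (x : ℝ) : u x 0 = ε * g x := by
  simpa using h.init x

lemma IsSol.eqn_real {α : ℝ} (h : IsSol n f g ε α (τ : EReal) u) {x t : ℝ} (ht : 0 < t)
    (htτ : t < τ) :
    pdt u x t = pdxx u x t / ((pdx u x t) ^ 2 + 1) - ((n : ℝ) - 1) / u x t
      + (1 / ε) * f x * Real.sqrt ((pdx u x t) ^ 2 + 1) :=
  h.eqn x t ht (EReal.coe_lt_coe_iff.mpr htτ)

/-- For short times the solution stays above half of the minimum of its initial value. -/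
lemma IsSol.exists_forall_half_le (h : IsSol n f g ε 1 (τ : EReal) u) (hA : A1 f g)
    (hε : 0 < ε) (hτ : 0 < τ) :
    ∃ T, 0 < T ∧ T < τ ∧ ∀ x t, 0 ≤ t → t ≤ T → ε * sInf (range g) / 2 ≤ u x t := by
  have hm := hA.sInf_g_pos
  have huc := ((isCompact_Icc (a := (0 : ℝ)) (b := 1)).prod
    (isCompact_Icc (a := (0 : ℝ)) (b := τ / 2))).uniformContinuousOn_of_continuous
    ((h.continuousOn (half_lt_self hτ)).mono fun q hq => ⟨hq.2.1, hq.2.2⟩)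
  rw [Metric.uniformContinuousOn_iff] at huc
  obtain ⟨δ, hδ, hclose⟩ := huc (ε * sInf (range g) / 2) (by positivity)
  refine ⟨min (τ / 2) (δ / 2), by positivity, (min_le_left _ _).trans_lt (half_lt_self hτ),
    fun x t ht0 ht => ?_⟩
  obtain ⟨y, hy, hxy⟩ := Function.Periodic.exists_mem_Ico₀ (f := fun y => u y t)
    (fun y => h.periodic y t) one_pos x
  have hxy' : u x t = u y t := hxy
  have hd := hclose (y, t) ⟨⟨hy.1, hy.2.le⟩, ht0, ht.trans (min_le_left _ _)⟩
    (y, 0) ⟨⟨hy.1, hy.2.le⟩, le_rfl, by positivity⟩ (by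
      simp only [Prod.dist_eq, dist_self, Real.dist_eq, sub_zero, abs_of_nonneg ht0]
      exact max_lt hδ (by linarith [ht.trans (min_le_right _ _)]))
  rw [Real.dist_eq] at hd
  simp only [h.init_eq] at hd
  have h1 := (abs_lt.mp hd).1
  have h2 := mul_le_mul_of_nonneg_left (hA.sInf_g_le y) hε.le
  rw [hxy']
  linarith

/-- The initial profile moving up or down at constant speed. -/
def movingProfile (ε c : ℝ) (g : ℝ → ℝ) (x t : ℝ) : ℝ := ε * g x + c * t

lemma pdx_movingProfile (hA : A1 f g) (c x t : ℝ) :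
    pdx (movingProfile ε c g) x t = ε * deriv g x := by
  have hg := hA.2.2.2.1.differentiable two_ne_zero
  simp [pdx, movingProfile]

lemma pdxx_movingProfile (hA : A1 f g) (c x t : ℝ) :
    pdxx (movingProfile ε c g) x t = ε * deriv (deriv g) x := by
  simp [pdxx, pdx_movingProfile hA]

lemma pdt_movingProfile (c x t : ℝ) : pdt (movingProfile ε c g) x t = c := by
  simp [pdt, movingProfile]

/-- For short times the solution moves away from its initial value with speed at most
`C₁ / ε`. -/
lemma IsSol.exists_abs_sub_init_le (h : IsSol n f g ε 1 (τ : EReal) u) (hA : A1 f g)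
    (hn : 2 ≤ n) (hε : 0 < ε) (hτ : 0 < τ) :
    ∃ T, 0 < T ∧ ∀ x t, 0 ≤ t → t ≤ T → |u x t - u x 0| ≤ C1 n f g ε / ε * t := by
  obtain ⟨T, hT, hTτ, hlow⟩ := h.exists_forall_half_le hA hε hτ
  refine ⟨T, hT, fun x t ht htT => ?_⟩
  have hn' : (0 : ℝ) < n - 1 := by
    have : (2 : ℝ) ≤ n := by exact_mod_cast hn
    linarith
  have hm := hA.sInf_g_pos
  have hg := hA.2.2.2.1
  have hcont (c : ℝ) : ContinuousOn (fun p : ℝ × ℝ => movingProfile ε c g p.1 p.2)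
      {p | 0 ≤ p.2 ∧ p.2 ≤ T} := by
    have := hg.continuous
    unfold movingProfile
    fun_prop
  have hper (c x t : ℝ) : movingProfile ε c g (x + 1) t = movingProfile ε c g x t := by
    simp only [movingProfile, hA.2.2.2.2.1 x]
  have hspace (c t : ℝ) : ContDiff ℝ 2 fun y => movingProfile ε c g y t := by
    unfold movingProfile
    fun_prop
  have htime (c x t : ℝ) : DifferentiableAt ℝ (movingProfile ε c g x) t := by
    unfold movingProfile
    fun_prop
  have hC (x : ℝ) : ε ^ 2 * |deriv (deriv g) x|
      + f x * √((ε * deriv g x) ^ 2 + 1) + 2 * ((n : ℝ) - 1) / sInf (range g) ≤ C1 n f g ε := by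
    have hf0 := (hA.2.2.1 x).le
    have hf := hA.le_sSup_f x
    unfold C1
    rw [mul_pow]
    gcongr
    · exact hA.abs_deriv_deriv_le x
    · exact hf0.trans hf
    · exact hA.sq_deriv_le x
  have hquot (x : ℝ) : |ε * deriv (deriv g) x / ((ε * deriv g x) ^ 2 + 1)|
      ≤ ε * |deriv (deriv g) x| := by
    rw [abs_div, abs_mul, abs_of_pos hε, abs_of_pos (by positivity : 0 < (ε * deriv g x) ^ 2 + 1)]
    exact div_le_self (by positivity) (by nlinarith [sq_nonneg (ε * deriv g x)])
  have hup : u x t - movingProfile ε (C1 n f g ε / ε) g x t ≤ 0 * exp (0 * t) := by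
    refine sub_le_mul_exp_of_contact le_rfl (fun x t _ _ => h.periodic x t)
      (fun x t _ _ => hper _ x t) (h.continuousOn hTτ) (hcont _)
      (fun x t h0 h1 => h.differentiableAt_time h0 (h1.trans_lt hTτ))
      (fun x t _ _ => htime _ x t) (fun t h0 h1 => h.contDiff_space h0 (h1.trans_lt hTτ))
      (fun t _ _ => hspace _ t) (fun x => by simp [movingProfile, h.init_eq]) ?_ x t ht htT
    intro x t ht htT _ hx hxx
    rw [pdx_movingProfile hA] at hx
    rw [pdxx_movingProfile hA] at hxx
    rw [pdt_movingProfile, h.eqn_real ht (htT.trans_lt hTτ), hx, zero_mul, sub_nonpos,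
      le_div_iff₀ hε]
    have h1 : pdxx u x t / ((ε * deriv g x) ^ 2 + 1)
        ≤ ε * deriv (deriv g) x / ((ε * deriv g x) ^ 2 + 1) := by gcongr
    have h2 := h1.trans ((le_abs_self _).trans (hquot x))
    have hu : 0 < u x t := h.pos x t ht.le (EReal.coe_lt_coe_iff.mpr (htT.trans_lt hTτ))
    have h3 : 0 < ((n : ℝ) - 1) / u x t := by positivity
    have h4 : 0 < 2 * ((n : ℝ) - 1) / sInf (range g) := by positivity
    calc _ ≤ (ε * |deriv (deriv g) x| + 1 / ε * f x * √((ε * deriv g x) ^ 2 + 1)) * ε := by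
          gcongr
          linarith
      _ = ε ^ 2 * |deriv (deriv g) x| + f x * √((ε * deriv g x) ^ 2 + 1) := by field_simp
      _ ≤ _ := by linarith [hC x]
  have hdown : movingProfile ε (-(C1 n f g ε / ε)) g x t - u x t ≤ 0 * exp (0 * t) := by
    refine sub_le_mul_exp_of_contact le_rfl (fun x t _ _ => hper _ x t)
      (fun x t _ _ => h.periodic x t) (hcont _) (h.continuousOn hTτ)
      (fun x t _ _ => htime _ x t)
      (fun x t h0 h1 => h.differentiableAt_time h0 (h1.trans_lt hTτ))
      (fun t _ _ => hspace _ t) (fun t h0 h1 => h.contDiff_space h0 (h1.trans_lt hTτ))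
      (fun x => by simp [movingProfile, h.init_eq]) ?_ x t ht htT
    intro x t ht htT _ hx hxx
    rw [pdx_movingProfile hA] at hx
    rw [pdxx_movingProfile hA] at hxx
    rw [pdt_movingProfile, h.eqn_real ht (htT.trans_lt hTτ), ← hx, zero_mul, sub_nonpos,
      neg_le, le_div_iff₀ hε]
    have h1 : ε * deriv (deriv g) x / ((ε * deriv g x) ^ 2 + 1)
        ≤ pdxx u x t / ((ε * deriv g x) ^ 2 + 1) := by gcongr
    have h2 := (abs_le.mp (hquot x)).1.trans h1
    have h3 : ((n : ℝ) - 1) / u x t ≤ ((n : ℝ) - 1) / (ε * sInf (range g) / 2) := by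
      gcongr
      exact hlow x t ht.le htT
    have hf := hA.2.2.1 x
    have h4 : 0 ≤ 1 / ε * f x * √((ε * deriv g x) ^ 2 + 1) := by positivity
    have h5 : 0 ≤ f x * √((ε * deriv g x) ^ 2 + 1) := by positivity
    calc _ ≤ (ε * |deriv (deriv g) x| + ((n : ℝ) - 1) / (ε * sInf (range g) / 2)) * ε := by
          gcongr
          linarith
      _ = ε ^ 2 * |deriv (deriv g) x| + 2 * ((n : ℝ) - 1) / sInf (range g) := by field_simp
      _ ≤ _ := by linarith [hC x]
  simp only [movingProfile, ← h.init_eq] at hup hdown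
  rw [abs_le]
  constructor <;> linarith

/-- Time increments of a solution bounded away from zero grow at most exponentially. -/
lemma IsSol.abs_sub_shift_le {α m M s T : ℝ} (h : IsSol n f g ε α (τ : EReal) u) (hn : 1 ≤ n)
    (hm : 0 < m) (hlow : ∀ x t, 0 < t → t < τ → m ≤ u x t) (hs : 0 ≤ s) (hT : 0 ≤ T)
    (hsT : T + s < τ) (hinit : ∀ x, |u x s - u x 0| ≤ M) (x : ℝ) :
    |u x (T + s) - u x T| ≤ M * exp (((n : ℝ) - 1) / m ^ 2 * T) := by
  have hn' : (0 : ℝ) ≤ n - 1 := sub_nonneg.mpr (by exact_mod_cast hn)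
  have hM : 0 ≤ M := (abs_nonneg _).trans (hinit 0)
  have hTτ : T < τ := by linarith
  set v : ℝ → ℝ → ℝ := fun x t => u x (t + s) with hv
  have hv_per (x t : ℝ) : v (x + 1) t = v x t := h.periodic x (t + s)
  have hv_cont : ContinuousOn (fun p : ℝ × ℝ => v p.1 p.2) {p | 0 ≤ p.2 ∧ p.2 ≤ T} :=
    (h.continuousOn hsT).comp (f := fun p : ℝ × ℝ => (p.1, p.2 + s)) (by fun_prop)
      fun p hp => ⟨add_nonneg hp.1 hs, by simpa using hp.2⟩
  have hv_t (x t : ℝ) (h0 : 0 < t) (h1 : t ≤ T) : DifferentiableAt ℝ (v x) t :=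
    differentiableAt_comp_add_const.mpr
      (h.differentiableAt_time (x := x) (by linarith) (by linarith))
  have hv_x (t : ℝ) (h0 : 0 < t) (h1 : t ≤ T) : ContDiff ℝ 2 fun y => v y t :=
    h.contDiff_space (by linarith) (by linarith)
  have hpdt (x t : ℝ) : pdt v x t = pdt u x (t + s) := deriv_comp_add_const (u x) s t
  have hv_eqn (x t : ℝ) (h0 : 0 < t) (h1 : t ≤ T) :
      pdt v x t = pdxx v x t / ((pdx v x t) ^ 2 + 1) - ((n : ℝ) - 1) / v x t
        + (1 / ε) * f x * Real.sqrt ((pdx v x t) ^ 2 + 1) :=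
    (hpdt x t).trans (h.eqn_real (by linarith) (by linarith))
  have hup := sub_le_mul_exp_of_contact (u := v) (v := u) (L := ((n : ℝ) - 1) / m ^ 2) hM
    (fun x t _ _ => hv_per x t) (fun x t _ _ => h.periodic x t) hv_cont (h.continuousOn hTτ)
    hv_t (fun x t h0 h1 => h.differentiableAt_time h0 (h1.trans_lt hTτ))
    hv_x (fun t h0 h1 => h.contDiff_space h0 (h1.trans_lt hTτ))
    (fun x => by simpa [hv] using (le_abs_self _).trans (hinit x))
    (fun x t h0 h1 hpos hx hxx => by
      rw [hv_eqn x t h0 h1, h.eqn_real h0 (h1.trans_lt hTτ), hx]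
      exact rhs_sub_le (by positivity) hn' hm (hlow x _ (by linarith) (by linarith))
        (hlow x t h0 (by linarith)) hpos hxx) x T hT le_rfl
  have hdown := sub_le_mul_exp_of_contact (u := u) (v := v) (L := ((n : ℝ) - 1) / m ^ 2) hM
    (fun x t _ _ => h.periodic x t) (fun x t _ _ => hv_per x t) (h.continuousOn hTτ) hv_cont
    (fun x t h0 h1 => h.differentiableAt_time h0 (h1.trans_lt hTτ)) hv_t
    (fun t h0 h1 => h.contDiff_space h0 (h1.trans_lt hTτ)) hv_x
    (fun x => by simpa [hv] using (le_abs_self _).trans ((abs_sub_comm _ _).trans_le (hinit x)))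
    (fun x t h0 h1 hpos hx hxx => by
      rw [hv_eqn x t h0 h1, h.eqn_real h0 (h1.trans_lt hTτ), hx]
      exact rhs_sub_le (by positivity) hn' hm (hlow x t h0 (by linarith))
        (hlow x _ (by linarith) (by linarith)) hpos hxx) x T hT le_rfl
  rw [abs_le]
  constructor <;> linarith

lemma IsSol.abs_mul_pdt_le (h : IsSol n f g ε 1 (τ : EReal) u) (hA : A1 f g) (hn : 2 ≤ n)
    (hε : 0 < ε) {cs : ℝ} (hcs : 0 < cs) (hlow : ∀ x t, 0 < t → t < τ → ε * cs ≤ u x t)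
    {t : ℝ} (x : ℝ) (ht : 0 < t) (htτ : t < τ) :
    |ε * pdt u x t| ≤ C1 n f g ε * exp (((n : ℝ) - 1) * t / (ε ^ 2 * cs ^ 2)) := by
  obtain ⟨T, hT, hshort⟩ := h.exists_abs_sub_init_le hA hn hε (ht.trans htτ)
  have hlim := (h.differentiableAt_time (x := x) ht htτ).hasDerivAt.tendsto_slope_zero_right.abs
  have hbound : |pdt u x t| ≤ C1 n f g ε / ε * exp (((n : ℝ) - 1) / (ε * cs) ^ 2 * t) := by
    refine le_of_tendsto hlim ?_
    filter_upwards [Ioo_mem_nhdsGT (lt_min hT (sub_pos.mpr htτ))] with s hs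
    have h1 := h.abs_sub_shift_le (by omega) (by positivity) hlow hs.1.le ht.le
      (by linarith [hs.2.trans_le (min_le_right _ _)])
      (fun y => hshort y s hs.1.le (hs.2.le.trans (min_le_left _ _))) x
    rw [smul_eq_mul, abs_mul, abs_inv, abs_of_pos hs.1, inv_mul_le_iff₀ hs.1]
    linarith
  rw [abs_mul, abs_of_pos hε]
  calc ε * |pdt u x t| ≤ ε * (C1 n f g ε / ε * exp (((n : ℝ) - 1) / (ε * cs) ^ 2 * t)) := by
        gcongr
    _ = _ := by
        rw [show ((n : ℝ) - 1) / (ε * cs) ^ 2 * t = ((n : ℝ) - 1) * t / (ε ^ 2 * cs ^ 2) by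
          rw [mul_pow]; ring]
        field_simp

end Solution

/-- Under (A1) with `α = 1`, `ε ∈ (0,1)`, `τ > 0`: if `u` is a positive
classical solution of the scaled problem on `ℝ × [0,τ)` whose time derivative extends
continuously to `ℝ × [0,τ)` and `u(x,t) ≥ ε c*` on `ℝ × (0,τ)`, then
`|ε u_t(x,t)| ≤ C₁ exp((n−1)t/(ε²c*²))` on `ℝ × (0,τ)`; in particular for every `k ∈ ℕ`
there is a constant `C` (independent of `ε`) bounding `|ε u_t|` on
`ℝ × (0, min(τ, k ε² c*²/(n−1)))`. -/
theorem time_derivative_bound (n : ℕ) (hn : 2 ≤ n) (f g : ℝ → ℝ) (hA1 : A1 f g)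
    (cs τ : ℝ) (hcs : 0 < cs) (hτ : 0 < τ) :
    (∀ ε : ℝ, 0 < ε → ε < 1 → ∀ u : ℝ → ℝ → ℝ,
      IsSol n f g ε 1 (τ : EReal) u →
      ContinuousOn (fun p : ℝ × ℝ => pdt u p.1 p.2) {p : ℝ × ℝ | 0 ≤ p.2 ∧ p.2 < τ} →
      (∀ x t : ℝ, 0 < t → t < τ → ε * cs ≤ u x t) →
      ∀ x t : ℝ, 0 < t → t < τ →
        |ε * pdt u x t| ≤ C1 n f g ε * Real.exp (((n : ℝ) - 1) * t / (ε ^ 2 * cs ^ 2))) ∧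
    (∀ k : ℕ, ∃ C : ℝ, ∀ ε : ℝ, 0 < ε → ε < 1 → ∀ u : ℝ → ℝ → ℝ,
      IsSol n f g ε 1 (τ : EReal) u →
      ContinuousOn (fun p : ℝ × ℝ => pdt u p.1 p.2) {p : ℝ × ℝ | 0 ≤ p.2 ∧ p.2 < τ} →
      (∀ x t : ℝ, 0 < t → t < τ → ε * cs ≤ u x t) →
      ∀ x t : ℝ, 0 < t → t < min τ ((k : ℝ) * ε ^ 2 * cs ^ 2 / ((n : ℝ) - 1)) →
        |ε * pdt u x t| ≤ C) := by
  refine ⟨fun ε hε _ u hu _ hlow x t ht htτ => hu.abs_mul_pdt_le hA1 hn hε hcs hlow x ht htτ,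
    fun k => ⟨C1 n f g 1 * exp k, fun ε hε hε1 u hu _ hlow x t ht htlt => ?_⟩⟩
  have hn' : (0 : ℝ) < n - 1 := by
    have : (2 : ℝ) ≤ n := by exact_mod_cast hn
    linarith
  refine (hu.abs_mul_pdt_le hA1 hn hε hcs hlow x ht (htlt.trans_le (min_le_left _ _))).trans ?_
  have hC := hA1.C1_le_C1_one (n := n) hε hε1
  have hC0 := hA1.C1_nonneg hn ε
  have hexp : ((n : ℝ) - 1) * t / (ε ^ 2 * cs ^ 2) ≤ k := by
    have h := (htlt.trans_le (min_le_right _ _)).le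
    rw [le_div_iff₀ hn'] at h
    rw [div_le_iff₀ (by positivity)]
    linarith
  gcongr
  exact hC0.trans hC
end
end

section
/- Assume (A1), α = 1, ε ∈ (0,1), and τ > 0. Let u be a positive classical solution of the scaled problem on ℝ × [0,τ) whose derivatives u_t and u_x extend continuously to ℝ × [0,τ), and suppose there is c* > 0 with u(x,t) ≥ ε c* for all (x,t) ∈ ℝ × (0,τ). Then for every k ∈ ℕ there exists a constant C > 0, depending only on n, f, g, c*, τ and k (in particular independent of ε ∈ (0,1)), such that |u_x(x,t)| ≤ C for all (x,t) ∈ ℝ × (0, min(τ, k ε² c*²/(n−1))). -/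
open Real Set Filter Topology

noncomputable section

theorem Function.Periodic.exists_bound_of_continuous {h : ℝ → ℝ} (hper : ∀ x, h (x + 1) = h x)
    (hc : Continuous h) : ∃ M, ∀ x, |h x| ≤ M := by
  obtain ⟨M, hM⟩ := (isCompact_Icc (a := (0 : ℝ)) (b := 1)).exists_bound_of_continuousOn
    hc.continuousOn
  refine ⟨M, fun x => ?_⟩
  obtain ⟨y, hy, hxy⟩ := Function.Periodic.exists_mem_Ico₀ (f := h) (c := 1) hper one_pos x
  rw [hxy]
  exact hM y ⟨hy.1, hy.2.le⟩

theorem deriv_periodic {h : ℝ → ℝ} (hper : ∀ x, h (x + 1) = h x) (x : ℝ) :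
    deriv h (x + 1) = deriv h x := by
  rw [← deriv_comp_add_const]
  simp only [hper]

/-- The necessary second order condition at a maximum. -/
theorem deriv_deriv_nonpos_of_forall_le_s6 {h : ℝ → ℝ} {x₀ : ℝ} (hc : ContinuousAt h x₀)
    (hmax : ∀ x, h x ≤ h x₀) : deriv (deriv h) x₀ ≤ 0 := by
  by_contra! hpos
  have hl : IsLocalMax h x₀ := Eventually.of_forall hmax
  have hmin := isLocalMin_of_deriv_deriv_pos hpos hl.deriv_eq_zero hc
  have heq : h =ᶠ[𝓝 x₀] fun _ => h x₀ := hmin.mono fun x hx => le_antisymm (hmax x) hx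
  have : deriv (deriv h) x₀ = 0 := by
    rw [heq.deriv.deriv_eq]
    simp
  exact hpos.ne' this

theorem HasDerivAt.nonneg_of_forall_Icc_le {h : ℝ → ℝ} {h' a b : ℝ} (hd : HasDerivAt h h' b)
    (hab : a < b) (hmax : ∀ t ∈ Icc a b, h t ≤ h b) : 0 ≤ h' := by
  refine ge_of_tendsto (hd.tendsto_slope.mono_left (nhdsLT_le_nhdsNE b)) ?_
  filter_upwards [Ioo_mem_nhdsLT hab] with t ht
  rw [slope_def_field]
  exact div_nonneg_of_nonpos (by linarith [hmax t ⟨ht.1.le, ht.2.le⟩]) (by linarith [ht.2])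

section PartialDerivatives

variable {u : ℝ → ℝ → ℝ} {x t : ℝ} {U : Set (ℝ × ℝ)}

theorem hasDerivAt_space (h : DifferentiableAt ℝ (fun p : ℝ × ℝ => u p.1 p.2) (x, t)) :
    HasDerivAt (fun y => u y t) (fderiv ℝ (fun p : ℝ × ℝ => u p.1 p.2) (x, t) (1, 0)) x :=
  HasFDerivAt.comp_hasDerivAt (l := fun p : ℝ × ℝ => u p.1 p.2) (f := fun y => (y, t)) x
    h.hasFDerivAt ((hasDerivAt_id x).prodMk (hasDerivAt_const x t))

theorem hasDerivAt_time (h : DifferentiableAt ℝ (fun p : ℝ × ℝ => u p.1 p.2) (x, t)) :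
    HasDerivAt (fun s => u x s) (fderiv ℝ (fun p : ℝ × ℝ => u p.1 p.2) (x, t) (0, 1)) t :=
  HasFDerivAt.comp_hasDerivAt (l := fun p : ℝ × ℝ => u p.1 p.2) (f := fun s => (x, s)) t
    h.hasFDerivAt ((hasDerivAt_const t x).prodMk (hasDerivAt_id t))

theorem pdx_eq_fderiv (h : DifferentiableAt ℝ (fun p : ℝ × ℝ => u p.1 p.2) (x, t)) :
    pdx u x t = fderiv ℝ (fun p : ℝ × ℝ => u p.1 p.2) (x, t) (1, 0) :=
  (hasDerivAt_space h).deriv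

theorem pdt_eq_fderiv (h : DifferentiableAt ℝ (fun p : ℝ × ℝ => u p.1 p.2) (x, t)) :
    pdt u x t = fderiv ℝ (fun p : ℝ × ℝ => u p.1 p.2) (x, t) (0, 1) :=
  (hasDerivAt_time h).deriv

theorem contDiffOn_pdx (hU : IsOpen U)
    (h : ContDiffOn ℝ (⊤ : ℕ∞) (fun p : ℝ × ℝ => u p.1 p.2) U) :
    ContDiffOn ℝ (⊤ : ℕ∞) (fun p : ℝ × ℝ => pdx u p.1 p.2) U := by
  refine ((h.fderiv_of_isOpen hU (m := (⊤ : ℕ∞)) (by simp)).clm_apply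
    (contDiffOn_const (c := ((1 : ℝ), (0 : ℝ))))).congr fun p hp => ?_
  exact pdx_eq_fderiv ((h.contDiffAt (hU.mem_nhds hp)).differentiableAt (by simp))

theorem contDiffOn_pdt (hU : IsOpen U)
    (h : ContDiffOn ℝ (⊤ : ℕ∞) (fun p : ℝ × ℝ => u p.1 p.2) U) :
    ContDiffOn ℝ (⊤ : ℕ∞) (fun p : ℝ × ℝ => pdt u p.1 p.2) U := by
  refine ((h.fderiv_of_isOpen hU (m := (⊤ : ℕ∞)) (by simp)).clm_apply
    (contDiffOn_const (c := ((0 : ℝ), (1 : ℝ))))).congr fun p hp => ?_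
  exact pdt_eq_fderiv ((h.contDiffAt (hU.mem_nhds hp)).differentiableAt (by simp))

theorem pdt_pdx_eq_pdx_pdt (hU : IsOpen U)
    (h : ContDiffOn ℝ (⊤ : ℕ∞) (fun p : ℝ × ℝ => u p.1 p.2) U) (hxt : (x, t) ∈ U) :
    pdt (pdx u) x t = pdx (pdt u) x t := by
  have hd : ∀ {v : ℝ → ℝ → ℝ}, ContDiffOn ℝ (⊤ : ℕ∞) (fun p : ℝ × ℝ => v p.1 p.2) U →
      ∀ p ∈ U, DifferentiableAt ℝ (fun p : ℝ × ℝ => v p.1 p.2) p := fun hv p hp =>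
    (hv.contDiffAt (hU.mem_nhds hp)).differentiableAt (by simp)
  have hF : DifferentiableAt ℝ (fderiv ℝ fun p : ℝ × ℝ => u p.1 p.2) (x, t) :=
    ((h.fderiv_of_isOpen hU (m := (⊤ : ℕ∞)) (by simp)).contDiffAt
      (hU.mem_nhds hxt)).differentiableAt (by simp)
  have hx : (fun p : ℝ × ℝ => pdx u p.1 p.2) =ᶠ[𝓝 (x, t)]
      fun p => fderiv ℝ (fun p : ℝ × ℝ => u p.1 p.2) p (1, 0) :=
    eventually_of_mem (hU.mem_nhds hxt) fun p hp => pdx_eq_fderiv (hd h p hp)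
  have ht : (fun p : ℝ × ℝ => pdt u p.1 p.2) =ᶠ[𝓝 (x, t)]
      fun p => fderiv ℝ (fun p : ℝ × ℝ => u p.1 p.2) p (0, 1) :=
    eventually_of_mem (hU.mem_nhds hxt) fun p hp => pdt_eq_fderiv (hd h p hp)
  have hsymm := (h.contDiffAt (hU.mem_nhds hxt)).isSymmSndFDerivAt
    (by simpa using WithTop.coe_le_coe.2 (le_top (a := (2 : ℕ∞))))
  rw [pdt_eq_fderiv (hd (contDiffOn_pdx hU h) _ hxt), pdx_eq_fderiv (hd (contDiffOn_pdt hU h) _ hxt),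
    hx.fderiv_eq, ht.fderiv_eq, fderiv_clm_apply hF (differentiableAt_const _),
    fderiv_clm_apply hF (differentiableAt_const _)]
  simpa using hsymm (0, 1) (1, 0)

end PartialDerivatives

section Equation

variable {n : ℕ} {f g : ℝ → ℝ} {ε α τ : ℝ} {u : ℝ → ℝ → ℝ}

theorem isOpen_strip (τ : ℝ) : IsOpen {p : ℝ × ℝ | 0 < p.2 ∧ (p.2 : EReal) < τ} := by
  simp only [EReal.coe_lt_coe_iff]
  exact (isOpen_lt continuous_const continuous_snd).inter (isOpen_lt continuous_snd continuous_const)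

/-- The equation for `pdx u`, at a critical point of `pdx u` in the space variable. -/
theorem IsSol.pdt_pdx_eq (hu : IsSol n f g ε α (τ : EReal) u) (hf : Differentiable ℝ f)
    {x t : ℝ} (ht : 0 < t) (htτ : t < τ) (hcrit : pdxx u x t = 0) :
    pdt (pdx u) x t = pdxx (pdx u) x t / ((pdx u x t) ^ 2 + 1)
      + ((n : ℝ) - 1) * pdx u x t / u x t ^ 2
      + (1 / ε) * deriv f x * Real.sqrt ((pdx u x t) ^ 2 + 1) := by
  have hU := isOpen_strip τ
  have htτ' : (t : EReal) < τ := EReal.coe_lt_coe_iff.2 htτ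
  have hmem : (x, t) ∈ {p : ℝ × ℝ | 0 < p.2 ∧ (p.2 : EReal) < τ} := ⟨ht, htτ'⟩
  have hd : ∀ {v : ℝ → ℝ → ℝ}, ContDiffOn ℝ (⊤ : ℕ∞) (fun p : ℝ × ℝ => v p.1 p.2)
      {p : ℝ × ℝ | 0 < p.2 ∧ (p.2 : EReal) < τ} → HasDerivAt (fun y => v y t) (pdx v x t) x :=
    fun hv => (hasDerivAt_space ((hv.contDiffAt (hU.mem_nhds hmem)).differentiableAt
      (by simp))).differentiableAt.hasDerivAt
  have hw := contDiffOn_pdx hU hu.smooth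
  have hu' := hd hu.smooth
  have hw' : HasDerivAt (fun y => pdx u y t) 0 x := hcrit ▸ hd hw
  have hwx : HasDerivAt (fun y => pdxx u y t) (pdxx (pdx u) x t) x := hd (contDiffOn_pdx hU hw)
  have hq : HasDerivAt (fun y => (pdx u y t) ^ 2 + 1) 0 x := by
    simpa using (hw'.pow 2).add_const 1
  have hq0 : (pdx u x t) ^ 2 + 1 ≠ 0 := by positivity
  have hu0 : u x t ≠ 0 := (hu.pos x t ht.le htτ').ne'
  have hrhs := ((hwx.div hq hq0).sub ((hasDerivAt_const x ((n : ℝ) - 1)).div hu' hu0)).add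
    (((hf x).hasDerivAt.const_mul (1 / ε)).mul (hq.sqrt hq0))
  have heq : (fun y => pdt u y t) = fun y => pdxx u y t / ((pdx u y t) ^ 2 + 1)
      - ((n : ℝ) - 1) / u y t + (1 / ε) * f y * Real.sqrt ((pdx u y t) ^ 2 + 1) :=
    funext fun y => hu.eqn y t ht htτ'
  rw [pdt_pdx_eq_pdx_pdt hU hu.smooth hmem, pdx, heq]
  refine hrhs.deriv.trans ?_
  field_simp
  ring

/-- One-sided gradient bound; `σ = ±1` selects the side. -/
theorem IsSol.sign_mul_pdx_le (hu : IsSol n f g ε α (τ : EReal) u) (hf : Differentiable ℝ f)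
    (hn : 1 ≤ n) (hε : 0 < ε) (hε1 : ε < 1) {cs M G σ : ℝ} (hcs : 0 < cs)
    (hM : ∀ x, |deriv f x| ≤ M) (hσ : |σ| = 1) (hG : 0 ≤ G)
    (hw : ContinuousOn (fun p : ℝ × ℝ => pdx u p.1 p.2) {p : ℝ × ℝ | 0 ≤ p.2 ∧ p.2 < τ})
    (hlow : ∀ x t : ℝ, 0 < t → t < τ → ε * cs ≤ u x t)
    (hinit : ∀ x, σ * pdx u x 0 ≤ G) {x t : ℝ} (ht : 0 < t) (htτ : t < τ) :
    σ * pdx u x t + 1 ≤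
      (1 + G) * Real.exp ((((n : ℝ) - 1) / cs ^ 2 + M + 1) / ε ^ 2 * t) := by
  set L := (((n : ℝ) - 1) / cs ^ 2 + M + 1) / ε ^ 2 with hL
  set Φ : ℝ → ℝ → ℝ := fun x t => (σ * pdx u x t + 1) * Real.exp (-(L * t)) with hΦ
  have hwper : ∀ y s, pdx u (y + 1) s = pdx u y s := fun y s =>
    deriv_periodic (h := fun y => u y s) (fun y => hu.periodic y s) y
  have hcont : ContinuousOn (fun p : ℝ × ℝ => Φ p.1 p.2) (Icc 0 1 ×ˢ Icc 0 t) := by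
    refine ContinuousOn.mul ((continuousOn_const.mul (hw.mono ?_)).add continuousOn_const) ?_
    · rintro ⟨y, s⟩ ⟨-, hs⟩
      exact ⟨hs.1, hs.2.trans_lt htτ⟩
    · fun_prop
  obtain ⟨⟨x₀, t₀⟩, ⟨-, ht₀ : t₀ ∈ Icc 0 t⟩, hmax⟩ := (isCompact_Icc.prod isCompact_Icc).exists_isMaxOn
    ⟨((0 : ℝ), (0 : ℝ)), ⟨by simp, by simp [ht.le]⟩⟩ hcont
  have hmax' : ∀ y, ∀ s ∈ Icc 0 t, Φ y s ≤ Φ x₀ t₀ := by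
    intro y s hs
    obtain ⟨z, hz, hyz⟩ := Function.Periodic.exists_mem_Ico₀ (f := fun y => Φ y s) (c := 1)
      (fun y => by simp only [hΦ, hwper]) one_pos y
    exact hyz.trans_le <| hmax (show (z, s) ∈ _ from ⟨⟨hz.1, hz.2.le⟩, hs⟩)
  suffices hle : Φ x₀ t₀ ≤ 1 + G by
    have h1 := (hmax' x t ⟨ht.le, le_rfl⟩).trans hle
    simp only [hΦ, Real.exp_neg] at h1
    rwa [← div_eq_mul_inv, div_le_iff₀ (Real.exp_pos _)] at h1
  by_contra! hgt
  have hM0 : 0 ≤ M := (abs_nonneg _).trans (hM 0)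
  have hn' : (0 : ℝ) ≤ (n : ℝ) - 1 := by
    have : (1 : ℝ) ≤ n := by exact_mod_cast hn
    linarith
  have hL0 : 0 ≤ L := by positivity
  have ht₀pos : 0 < t₀ := by
    refine ht₀.1.lt_of_ne fun h0 => ?_
    rw [← h0] at hgt
    simp only [hΦ, mul_zero, neg_zero, Real.exp_zero, mul_one] at hgt
    linarith [hinit x₀]
  have ht₀τ : t₀ < τ := ht₀.2.trans_lt htτ
  set w := pdx u x₀ t₀ with hwdef
  have hwpos : 0 < σ * w := by
    by_contra! hneg
    have h1 : Real.exp (-(L * t₀)) ≤ 1 :=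
      Real.exp_le_one_iff.2 (neg_nonpos.2 (mul_nonneg hL0 ht₀pos.le))
    have h2 : Φ x₀ t₀ ≤ 1 := by
      simp only [hΦ]
      nlinarith [Real.exp_pos (-(L * t₀))]
    linarith
  have hU := isOpen_strip τ
  have hmem : (x₀, t₀) ∈ {p : ℝ × ℝ | 0 < p.2 ∧ (p.2 : EReal) < τ} :=
    ⟨ht₀pos, EReal.coe_lt_coe_iff.2 ht₀τ⟩
  have hwd : DifferentiableAt ℝ (fun p : ℝ × ℝ => pdx u p.1 p.2) (x₀, t₀) :=
    ((contDiffOn_pdx hU hu.smooth).contDiffAt (hU.mem_nhds hmem)).differentiableAt (by simp)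
  have hspace : ∀ y, σ * pdx u y t₀ ≤ σ * pdx u x₀ t₀ := fun y => by
    have := le_of_mul_le_mul_right (hmax' y t₀ ht₀) (Real.exp_pos _)
    linarith
  have hσ2 : σ * σ = 1 := by rw [← abs_mul_abs_self, hσ, mul_one]
  have hσ0 : σ ≠ 0 := fun h => by simp [h] at hσ2
  have hcrit : pdxx u x₀ t₀ = 0 := by
    have h1 : deriv (fun y => σ * pdx u y t₀) x₀ = 0 :=
      IsLocalMax.deriv_eq_zero (Eventually.of_forall hspace)
    rw [deriv_const_mul_field] at h1
    exact (mul_eq_zero.1 h1).resolve_left hσ0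
  have hconc : σ * pdxx (pdx u) x₀ t₀ ≤ 0 := by
    have h1 := deriv_deriv_nonpos_of_forall_le_s6 (h := fun y => σ * pdx u y t₀)
      ((hasDerivAt_space hwd).continuousAt.const_mul σ) hspace
    rw [show deriv (fun y => σ * pdx u y t₀) = fun y => σ * pdxx u y t₀ from
      funext fun y => deriv_const_mul_field σ, deriv_const_mul_field] at h1
    exact h1
  have htime : L * (σ * w + 1) ≤ σ * pdt (pdx u) x₀ t₀ := by
    have h1 : HasDerivAt (fun s => pdx u x₀ s) (pdt (pdx u) x₀ t₀) t₀ :=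
      (hasDerivAt_time hwd).differentiableAt.hasDerivAt
    have h2 : HasDerivAt (fun s => Real.exp (-(L * s))) (Real.exp (-(L * t₀)) * -(L * 1)) t₀ :=
      (((hasDerivAt_id t₀).const_mul L).neg).exp
    have h3 := HasDerivAt.nonneg_of_forall_Icc_le (((h1.const_mul σ).add_const 1).mul h2) ht₀pos
      fun s hs => hmax' x₀ s ⟨hs.1, hs.2.trans ht₀.2⟩
    have h4 : 0 ≤ (σ * pdt (pdx u) x₀ t₀ - L * (σ * w + 1)) * Real.exp (-(L * t₀)) := by
      linarith
    linarith [nonneg_of_mul_nonneg_left h4 (Real.exp_pos _)]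
  rw [hu.pdt_pdx_eq hf ht₀pos ht₀τ hcrit, ← hwdef] at htime
  have hlow₀ := hlow x₀ t₀ ht₀pos ht₀τ
  have hzero : ((n : ℝ) - 1) * (σ * w) / u x₀ t₀ ^ 2 ≤
      ((n : ℝ) - 1) / cs ^ 2 / ε ^ 2 * (σ * w) := by
    calc _ ≤ ((n : ℝ) - 1) * (σ * w) / (ε * cs) ^ 2 := by gcongr
      _ = _ := by field_simp
  have hdiff : σ * pdxx (pdx u) x₀ t₀ / (w ^ 2 + 1) ≤ 0 :=
    div_nonpos_of_nonpos_of_nonneg hconc (by positivity)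
  have hsqrt : Real.sqrt (w ^ 2 + 1) ≤ σ * w + 1 := by
    refine Real.sqrt_le_iff.2 ⟨by linarith, ?_⟩
    nlinarith [show (σ * w) ^ 2 = w ^ 2 by rw [mul_pow, sq σ, hσ2, one_mul]]
  have hforce : σ * ((1 / ε) * deriv f x₀ * Real.sqrt (w ^ 2 + 1)) ≤ M / ε ^ 2 * (σ * w + 1) := by
    have h1 : σ * deriv f x₀ ≤ M := by
      refine (le_abs_self _).trans ?_
      rw [abs_mul, hσ, one_mul]
      exact hM x₀
    have h2 : 1 / ε ≤ 1 / ε ^ 2 := by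
      gcongr
      nlinarith
    calc _ = (1 / ε) * (σ * deriv f x₀) * Real.sqrt (w ^ 2 + 1) := by ring
      _ ≤ (1 / ε) * M * Real.sqrt (w ^ 2 + 1) := by gcongr
      _ ≤ (1 / ε ^ 2) * M * (σ * w + 1) := by gcongr
      _ = _ := by ring
  have hLexp : L * (σ * w + 1) = ((n : ℝ) - 1) / cs ^ 2 / ε ^ 2 * (σ * w)
      + ((n : ℝ) - 1) / cs ^ 2 / ε ^ 2 + M / ε ^ 2 * (σ * w + 1) + (σ * w + 1) / ε ^ 2 := by
    rw [hL]; ring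
  have hp1 : 0 ≤ ((n : ℝ) - 1) / cs ^ 2 / ε ^ 2 := by positivity
  have hp2 : 0 < (σ * w + 1) / ε ^ 2 := by positivity
  have hsplit : σ * (pdxx (pdx u) x₀ t₀ / (w ^ 2 + 1) + ((n : ℝ) - 1) * w / u x₀ t₀ ^ 2
      + (1 / ε) * deriv f x₀ * Real.sqrt (w ^ 2 + 1)) =
      σ * pdxx (pdx u) x₀ t₀ / (w ^ 2 + 1) + ((n : ℝ) - 1) * (σ * w) / u x₀ t₀ ^ 2
      + σ * ((1 / ε) * deriv f x₀ * Real.sqrt (w ^ 2 + 1)) := by ring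
  linarith

end Equation

/-- Under (A1) with `α = 1`, `ε ∈ (0,1)`, `τ > 0`: if `u` is a positive
classical solution of the scaled problem on `ℝ × [0,τ)` whose derivatives `u_t` and `u_x`
extend continuously to `ℝ × [0,τ)` and `u(x,t) ≥ ε c*` on `ℝ × (0,τ)`, then for every
`k ∈ ℕ` there is `C > 0`, independent of `ε ∈ (0,1)`, such that `|u_x(x,t)| ≤ C` on
`ℝ × (0, min(τ, k ε² c*²/(n−1)))`. -/
theorem space_derivative_bound (n : ℕ) (hn : 2 ≤ n) (f g : ℝ → ℝ) (hA1 : A1 f g)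
    (cs τ : ℝ) (hcs : 0 < cs) (hτ : 0 < τ) :
    ∀ k : ℕ, ∃ C : ℝ, 0 < C ∧ ∀ ε : ℝ, 0 < ε → ε < 1 → ∀ u : ℝ → ℝ → ℝ,
      IsSol n f g ε 1 (τ : EReal) u →
      ContinuousOn (fun p : ℝ × ℝ => pdt u p.1 p.2) {p : ℝ × ℝ | 0 ≤ p.2 ∧ p.2 < τ} →
      ContinuousOn (fun p : ℝ × ℝ => pdx u p.1 p.2) {p : ℝ × ℝ | 0 ≤ p.2 ∧ p.2 < τ} →
      (∀ x t : ℝ, 0 < t → t < τ → ε * cs ≤ u x t) →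
      ∀ x t : ℝ, 0 < t → t < min τ ((k : ℝ) * ε ^ 2 * cs ^ 2 / ((n : ℝ) - 1)) →
        |pdx u x t| ≤ C := by
  intro k
  obtain ⟨hf, hfper, -, hg, hgper, -⟩ := hA1
  obtain ⟨M, hM⟩ := Function.Periodic.exists_bound_of_continuous (deriv_periodic hfper)
    (hf.continuous_deriv le_rfl)
  obtain ⟨G, hG⟩ := Function.Periodic.exists_bound_of_continuous (deriv_periodic hgper)
    (hg.continuous_deriv (by norm_num))
  have hM0 : 0 ≤ M := (abs_nonneg _).trans (hM 0)
  have hG0 : 0 ≤ G := (abs_nonneg _).trans (hG 0)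
  have hn' : (0 : ℝ) < (n : ℝ) - 1 := by
    have : (2 : ℝ) ≤ n := by exact_mod_cast hn
    linarith
  set B := ((n : ℝ) - 1) / cs ^ 2 + M + 1
  have hB : 0 ≤ B := by positivity
  refine ⟨(1 + G) * Real.exp (B * (k * cs ^ 2 / ((n : ℝ) - 1))), by positivity, ?_⟩
  intro ε hε hε1 u hu _ hw hlow x t ht htmin
  obtain ⟨htτ, htk⟩ := lt_min_iff.1 htmin
  have hinit : ∀ y, |pdx u y 0| ≤ G := fun y => by
    have h1 : (fun z => u z 0) = fun z => ε * g z := funext fun z => by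
      rw [hu.init, Real.rpow_one]
    rw [pdx, h1, deriv_const_mul_field, abs_mul, abs_of_pos hε]
    nlinarith [hG y, abs_nonneg (deriv g y)]
  have hside : ∀ σ : ℝ, |σ| = 1 → σ * pdx u x t ≤
      (1 + G) * Real.exp (B * (k * cs ^ 2 / ((n : ℝ) - 1))) := by
    intro σ hσ
    have h1 := hu.sign_mul_pdx_le (hf.differentiable (by norm_num)) (by omega) hε hε1 hcs hM hσ
      hG0 hw hlow (fun y => (le_abs_self _).trans (by rw [abs_mul, hσ, one_mul]; exact hinit y))
      ht htτ (x := x)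
    have h2 : B / ε ^ 2 * t ≤ B * (k * cs ^ 2 / ((n : ℝ) - 1)) := by
      calc B / ε ^ 2 * t ≤ B / ε ^ 2 * (k * ε ^ 2 * cs ^ 2 / ((n : ℝ) - 1)) := by gcongr
        _ = _ := by field_simp
    have h3 : (1 + G) * Real.exp (B / ε ^ 2 * t) ≤
      (1 + G) * Real.exp (B * (k * cs ^ 2 / ((n : ℝ) - 1))) := by gcongr
    linarith
  have h1 := hside 1 (by simp)
  have h2 := hside (-1) (by simp)
  exact abs_le.2 ⟨by linarith, by linarith⟩
end
end
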